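/- Assume that E[W · exp(c|X|)] < ∞ for every c > 0. Then the function Ȳ is twice differentiable on ℝ^{ī·j̄}, its gradient vanishes at θ*, ∇Ȳ(θ*) = 0, and its Hessian at θ* equals minus the matrix of the quadratic form Γ: for all u ∈ ℝ^{ī·j̄}, (Hess Ȳ(θ*))[u⊗u] = −Γ[u⊗u]. -/

import Mathlib

open scoped BigOperators
open MeasureTheory

/-- Euclidean inner product on `ℝ^{j̄}`. -/
noncomputable def dot {n : ℕ} (x y : Fin n → ℝ) : ℝ := ∑ j, x j * y j

/-- Euclidean norm on `ℝ^{j̄}` (coordinates indexed by `Fin n`). -/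
noncomputable def normE {n : ℕ} (x : Fin n → ℝ) : ℝ := Real.sqrt (∑ j, (x j) ^ 2)

/-- The ratio (softmax) function `ρ^i(x,θ)` for a full parameter family
`θ : I → ℝ^{j̄}` (indices `I = {0,…,ī}`). -/
noncomputable def rho {ibar jbar : ℕ} (x : Fin jbar → ℝ)
    (θ : Fin (ibar + 1) → Fin jbar → ℝ) (i : Fin (ibar + 1)) : ℝ :=
  (∑ i', Real.exp (dot x (θ i' - θ i)))⁻¹

/-- Extend a parameter `θ = (θ^α)_{α∈I₀}` to `I = {0,…,ī}` by pinning `θ^0 = 0`. -/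
noncomputable def pad {ibar jbar : ℕ} (θ : Fin ibar → Fin jbar → ℝ) :
    Fin (ibar + 1) → Fin jbar → ℝ :=
  Fin.cases 0 θ

/-- `Λ(w,x) = w ∑_{i∈I} exp(x·ϑ^{*i})`. -/
noncomputable def Lam {ibar jbar : ℕ} (ϑs : Fin (ibar + 1) → Fin jbar → ℝ)
    (w : ℝ) (x : Fin jbar → ℝ) : ℝ :=
  w * ∑ i, Real.exp (dot x (ϑs i))

/-- `θ* = (ϑ^{*i} − ϑ^{*0})_{i∈I₀}`. -/
noncomputable def thetaStar {ibar jbar : ℕ} (ϑs : Fin (ibar + 1) → Fin jbar → ℝ) :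
    Fin ibar → Fin jbar → ℝ :=
  fun α => ϑs α.succ - ϑs 0

/-- The integrand of `Ȳ(θ)`:
`ω ↦ ∑_{i∈I} log(ρ^i(X,θ)/ρ^i(X,θ*)) ρ^i(X,θ*) Λ(W,X)`. -/
noncomputable def YbarInt {ibar jbar : ℕ} {Ω : Type*}
    (X : Ω → Fin jbar → ℝ) (W : Ω → ℝ) (ϑs : Fin (ibar + 1) → Fin jbar → ℝ)
    (θ : Fin ibar → Fin jbar → ℝ) (ω : Ω) : ℝ :=
  (∑ i : Fin (ibar + 1),
    Real.log (rho (X ω) (pad θ) i / rho (X ω) (pad (thetaStar ϑs)) i) *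
      rho (X ω) (pad (thetaStar ϑs)) i) * Lam ϑs (W ω) (X ω)

/-- `Ȳ(θ) = E[∑_{i∈I} log(ρ^i(X,θ)/ρ^i(X,θ*)) ρ^i(X,θ*) Λ(W,X)]`. -/
noncomputable def Ybar {ibar jbar : ℕ} {Ω : Type*} [MeasurableSpace Ω]
    (P : Measure Ω) (X : Ω → Fin jbar → ℝ) (W : Ω → ℝ)
    (ϑs : Fin (ibar + 1) → Fin jbar → ℝ) (θ : Fin ibar → Fin jbar → ℝ) : ℝ :=
  ∫ ω, YbarInt X W ϑs θ ω ∂P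

/-- The integrand of the quadratic form `Γ[u⊗u]`:
`ω ↦ (V₀(X,θ*) ⊗ X ⊗ X)[u⊗u] Λ(W,X)`. -/
noncomputable def GamInt {ibar jbar : ℕ} {Ω : Type*}
    (X : Ω → Fin jbar → ℝ) (W : Ω → ℝ) (ϑs : Fin (ibar + 1) → Fin jbar → ℝ)
    (u : Fin ibar → Fin jbar → ℝ) (ω : Ω) : ℝ :=
  (∑ α : Fin ibar, ∑ α' : Fin ibar, ∑ j : Fin jbar, ∑ j' : Fin jbar,
    ((if α = α' then rho (X ω) (pad (thetaStar ϑs)) α.succ else 0) -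
      rho (X ω) (pad (thetaStar ϑs)) α.succ *
        rho (X ω) (pad (thetaStar ϑs)) α'.succ) *
      X ω j * X ω j' * u α j * u α' j') * Lam ϑs (W ω) (X ω)

/-- The quadratic form `Γ[u⊗u] = E[(V₀(X,θ*) ⊗ X ⊗ X)[u⊗u] Λ(W,X)]`. -/
noncomputable def Gam {ibar jbar : ℕ} {Ω : Type*} [MeasurableSpace Ω]
    (P : Measure Ω) (X : Ω → Fin jbar → ℝ) (W : Ω → ℝ)
    (ϑs : Fin (ibar + 1) → Fin jbar → ℝ) (u : Fin ibar → Fin jbar → ℝ) : ℝ :=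
  ∫ ω, GamInt X W ϑs u ω ∂P


noncomputable def smx {ι E : Type*} [Fintype ι] [NormedAddCommGroup E] [NormedSpace ℝ E]
    (L : ι → E →L[ℝ] ℝ) (θ : E) (i : ι) : ℝ :=
  Real.exp (L i θ) / ∑ k, Real.exp (L k θ)

section smx
variable {ι E : Type*} [Fintype ι] [Nonempty ι] [NormedAddCommGroup E] [NormedSpace ℝ E]
  (L : ι → E →L[ℝ] ℝ)

theorem smx_S_pos (θ : E) : 0 < ∑ k, Real.exp (L k θ) :=
  Finset.sum_pos (fun _ _ => Real.exp_pos _) Finset.univ_nonempty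

theorem smx_pos (θ : E) (i : ι) : 0 < smx L θ i :=
  div_pos (Real.exp_pos _) (smx_S_pos L θ)

theorem smx_le_one (θ : E) (i : ι) : smx L θ i ≤ 1 := by
  unfold smx
  rw [div_le_one (smx_S_pos L θ)]
  exact Finset.single_le_sum (f := fun k => Real.exp (L k θ))
    (fun _ _ => (Real.exp_pos _).le) (Finset.mem_univ i)

theorem smx_sum (θ : E) : ∑ i, smx L θ i = 1 := by
  unfold smx
  rw [← Finset.sum_div, div_self (smx_S_pos L θ).ne']

theorem smx_S_deriv (θ : E) : HasFDerivAt (fun θ => ∑ k, Real.exp (L k θ))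
    (∑ k, Real.exp (L k θ) • L k) θ :=
  HasFDerivAt.fun_sum fun k _ => (L k).hasFDerivAt.exp

theorem smx_log_deriv (θ : E) : HasFDerivAt (fun θ => Real.log (∑ k, Real.exp (L k θ)))
    (∑ k, smx L θ k • L k) θ := by
  convert (smx_S_deriv L θ).log (smx_S_pos L θ).ne' using 1
  rw [Finset.smul_sum]
  refine Finset.sum_congr rfl fun k _ => ?_
  rw [smul_smul, smx, div_eq_inv_mul]

theorem smx_deriv (θ : E) (i : ι) : HasFDerivAt (fun θ => smx L θ i)
    (smx L θ i • (L i - ∑ k, smx L θ k • L k)) θ := by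
  have h : ∀ θ, smx L θ i = Real.exp (L i θ - Real.log (∑ k, Real.exp (L k θ))) := by
    intro θ
    rw [Real.exp_sub, Real.exp_log (smx_S_pos L θ), smx]
  simp only [h]
  have := ((L i).hasFDerivAt.sub (smx_log_deriv L θ)).exp
  simpa only [h, Pi.sub_apply] using this

end smx

noncomputable def eFun {ibar jbar : ℕ} (i : Fin (ibar + 1)) (j : Fin jbar) :
    (Fin ibar → Fin jbar → ℝ) →L[ℝ] ℝ :=
  Fin.cases (motive := fun _ => (Fin ibar → Fin jbar → ℝ) →L[ℝ] ℝ) 0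
    (fun α => (ContinuousLinearMap.proj (R := ℝ) (φ := fun _ : Fin jbar => ℝ) j).comp
      (ContinuousLinearMap.proj (R := ℝ) (φ := fun _ : Fin ibar => Fin jbar → ℝ) α)) i

theorem eFun_apply {ibar jbar : ℕ} (i : Fin (ibar + 1)) (j : Fin jbar)
    (θ : Fin ibar → Fin jbar → ℝ) : eFun i j θ = pad θ i j := by
  refine Fin.cases ?_ (fun α => ?_) i <;> simp [eFun, pad]

theorem eFun_norm {ibar jbar : ℕ} (i : Fin (ibar + 1)) (j : Fin jbar) :
    ‖(eFun i j : (Fin ibar → Fin jbar → ℝ) →L[ℝ] ℝ)‖ ≤ 1 := by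
  refine ContinuousLinearMap.opNorm_le_bound _ zero_le_one fun θ => ?_
  rw [eFun_apply, one_mul]
  refine Fin.cases ?_ (fun α => ?_) i
  · simp [pad]
  · exact (norm_le_pi_norm (θ α) j).trans (norm_le_pi_norm θ α)

noncomputable def LF {ibar jbar : ℕ} (x : Fin jbar → ℝ) (i : Fin (ibar + 1)) :
    (Fin ibar → Fin jbar → ℝ) →L[ℝ] ℝ := ∑ j, x j • eFun i j

theorem LF_apply {ibar jbar : ℕ} (x : Fin jbar → ℝ) (i : Fin (ibar + 1))
    (θ : Fin ibar → Fin jbar → ℝ) : LF x i θ = dot x (pad θ i) := by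
  simp [LF, dot, eFun_apply, _root_.sum_apply]

theorem normE_nonneg' {n : ℕ} (x : Fin n → ℝ) : 0 ≤ normE x := Real.sqrt_nonneg _

theorem abs_le_normE {n : ℕ} (x : Fin n → ℝ) (j : Fin n) : |x j| ≤ normE x := by
  unfold normE
  rw [← Real.sqrt_sq_eq_abs]
  exact Real.sqrt_le_sqrt (Finset.single_le_sum (f := fun j => x j ^ 2)
    (fun _ _ => sq_nonneg _) (Finset.mem_univ j))

theorem LF_norm {ibar jbar : ℕ} (x : Fin jbar → ℝ) (i : Fin (ibar + 1)) :
    ‖(LF x i : (Fin ibar → Fin jbar → ℝ) →L[ℝ] ℝ)‖ ≤ jbar * normE x := by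
  unfold LF
  refine (norm_sum_le _ _).trans ?_
  calc _ ≤ ∑ j : Fin jbar, normE x := by
        refine Finset.sum_le_sum fun j _ => ?_
        rw [norm_smul, Real.norm_eq_abs]
        calc _ ≤ |x j| * 1 := mul_le_mul_of_nonneg_left (eFun_norm i j) (abs_nonneg _)
          _ ≤ _ := by rw [mul_one]; exact abs_le_normE x j
    _ = _ := by simp

theorem dot_le {n : ℕ} (x y : Fin n → ℝ) : dot x y ≤ normE x * normE y := by
  unfold dot normE
  exact Real.sum_mul_le_sqrt_mul_sqrt _ _ _

theorem dot_sub' {n : ℕ} (x y z : Fin n → ℝ) : dot x (y - z) = dot x y - dot x z := by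
  simp [dot, mul_sub]

theorem rho_eq {ibar jbar : ℕ} (x : Fin jbar → ℝ) (θ : Fin ibar → Fin jbar → ℝ)
    (i : Fin (ibar + 1)) : rho x (pad θ) i = smx (LF x) θ i := by
  unfold rho smx
  simp only [LF_apply, dot_sub', Real.exp_sub]
  rw [← Finset.sum_div, inv_div]

section main
variable {ibar jbar : ℕ} {Ω : Type*} [MeasurableSpace Ω] {P : Measure Ω}
    {X : Ω → Fin jbar → ℝ} {W : Ω → ℝ} (ϑs : Fin (ibar + 1) → Fin jbar → ℝ)

theorem YbarInt_eq (θ : Fin ibar → Fin jbar → ℝ) (ω : Ω) :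
    YbarInt X W ϑs θ ω = Lam ϑs (W ω) (X ω) *
      (∑ i, smx (LF (X ω)) (thetaStar ϑs) i * (LF (X ω) i θ - LF (X ω) i (thetaStar ϑs))
      - (Real.log (∑ k, Real.exp (LF (X ω) k θ))
        - Real.log (∑ k, Real.exp (LF (X ω) k (thetaStar ϑs))))) := by
  have hl : ∀ (θ : Fin ibar → Fin jbar → ℝ) i, Real.log (smx (LF (X ω)) θ i) =
      LF (X ω) i θ - Real.log (∑ k, Real.exp (LF (X ω) k θ)) := by
    intro θ i
    rw [smx, Real.log_div (Real.exp_pos _).ne' (smx_S_pos _ θ).ne', Real.log_exp]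
  unfold YbarInt
  simp only [rho_eq]
  rw [mul_comm]
  congr 1
  have : ∀ i, Real.log (smx (LF (X ω)) θ i / smx (LF (X ω)) (thetaStar ϑs) i) *
      smx (LF (X ω)) (thetaStar ϑs) i =
      smx (LF (X ω)) (thetaStar ϑs) i * (LF (X ω) i θ - LF (X ω) i (thetaStar ϑs))
      - smx (LF (X ω)) (thetaStar ϑs) i * (Real.log (∑ k, Real.exp (LF (X ω) k θ))
        - Real.log (∑ k, Real.exp (LF (X ω) k (thetaStar ϑs)))) := by
    intro i
    rw [Real.log_div (smx_pos _ _ _).ne' (smx_pos _ _ _).ne', hl, hl]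
    ring
  simp only [this]
  rw [Finset.sum_sub_distrib, ← Finset.sum_mul, smx_sum, one_mul]

theorem YbarInt_deriv (θ : Fin ibar → Fin jbar → ℝ) (ω : Ω) :
    HasFDerivAt (fun θ => YbarInt X W ϑs θ ω)
      (∑ i, ∑ j, (Lam ϑs (W ω) (X ω) * ((smx (LF (X ω)) (thetaStar ϑs) i
        - smx (LF (X ω)) θ i) * X ω j)) • eFun i j) θ := by
  simp only [YbarInt_eq]
  have h1 : HasFDerivAt (fun θ => ∑ i, smx (LF (X ω)) (thetaStar ϑs) i *
      (LF (X ω) i θ - LF (X ω) i (thetaStar ϑs)))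
      (∑ i, smx (LF (X ω)) (thetaStar ϑs) i • LF (X ω) i) θ :=
    HasFDerivAt.fun_sum fun i _ => ((LF (X ω) i).hasFDerivAt.sub_const _).const_mul _
  refine ((h1.sub ((smx_log_deriv (LF (X ω)) θ).sub_const
    (Real.log (∑ k, Real.exp (LF (X ω) k (thetaStar ϑs)))))).const_mul
    (Lam ϑs (W ω) (X ω))).congr_fderiv (Eq.symm ?_)
  rw [← Finset.sum_sub_distrib, Finset.smul_sum]
  refine Finset.sum_congr rfl fun i _ => ?_
  rw [← sub_smul]
  simp only [LF, Finset.smul_sum, smul_smul]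

theorem meas_dot (hX : Measurable X) (y : Fin jbar → ℝ) :
    Measurable fun ω => dot (X ω) y := by
  unfold dot
  exact Finset.measurable_sum _ fun j _ => ((measurable_pi_apply j).comp hX).mul_const _

theorem meas_Lam (hX : Measurable X) (hW : Measurable W) :
    Measurable fun ω => Lam ϑs (W ω) (X ω) := by
  unfold Lam
  exact hW.mul (Finset.measurable_sum _ fun i _ => (meas_dot hX _).exp)

theorem meas_smx (hX : Measurable X) (θ : Fin ibar → Fin jbar → ℝ) (i : Fin (ibar + 1)) :
    Measurable fun ω => smx (LF (X ω)) θ i := by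
  unfold smx
  simp only [LF_apply]
  exact (meas_dot hX _).exp.div (Finset.measurable_sum _ fun i _ => (meas_dot hX _).exp)

theorem meas_Y (hX : Measurable X) (hW : Measurable W) (θ : Fin ibar → Fin jbar → ℝ) :
    Measurable fun ω => YbarInt X W ϑs θ ω := by
  unfold YbarInt
  simp only [rho_eq]
  exact (Finset.measurable_sum _ fun i _ => (((meas_smx hX _ _).div (meas_smx hX _ _)).log).mul
    (meas_smx hX _ _)).mul (meas_Lam ϑs hX hW)

theorem meas_normE (hX : Measurable X) : Measurable fun ω => normE (X ω) := by
  unfold normE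
  exact (Finset.measurable_sum _ fun j _ =>
    ((measurable_pi_apply j).comp hX).pow_const 2).sqrt

theorem Lam_nonneg (hWpos : ∀ ω, 0 ≤ W ω) (ω : Ω) : 0 ≤ Lam ϑs (W ω) (X ω) :=
  mul_nonneg (hWpos ω) (Finset.sum_nonneg fun _ _ => (Real.exp_pos _).le)

theorem int_H (hX : Measurable X) (hW : Measurable W) (hWpos : ∀ ω, 0 ≤ W ω)
    (hint : ∀ c : ℝ, 0 < c →
      Integrable (fun ω => W ω * Real.exp (c * normE (X ω))) P) :
    Integrable (fun ω => Lam ϑs (W ω) (X ω) * Real.exp (2 * normE (X ω))) P := by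
  have h : Integrable (fun ω => ∑ i, W ω * Real.exp ((normE (ϑs i) + 2) * normE (X ω))) P :=
    integrable_finsetSum _ fun i _ => hint _ (by have := normE_nonneg' (ϑs i); linarith)
  refine h.mono' ((meas_Lam ϑs hX hW).mul
    ((meas_normE hX).const_mul 2).exp).aestronglyMeasurable (ae_of_all _ fun ω => ?_)
  rw [Real.norm_eq_abs, abs_of_nonneg (mul_nonneg (Lam_nonneg ϑs hWpos ω) (Real.exp_pos _).le),
    Lam, mul_assoc, Finset.sum_mul, Finset.mul_sum]
  refine Finset.sum_le_sum fun i _ => mul_le_mul_of_nonneg_left ?_ (hWpos ω)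
  rw [← Real.exp_add, Real.exp_le_exp]
  have := dot_le (X ω) (ϑs i)
  linarith

theorem le_exp2 {t : ℝ} (ht : 0 ≤ t) : t ≤ Real.exp (2 * t) := by
  have := Real.add_one_le_exp (2 * t); linarith

theorem sq_le_exp2 {t : ℝ} (ht : 0 ≤ t) : t * t ≤ Real.exp (2 * t) := by
  have := Real.add_one_le_exp t
  rw [two_mul, Real.exp_add]
  exact mul_le_mul (by linarith) (by linarith) ht (Real.exp_pos _).le

/-- coefficient of the first derivative -/
noncomputable def gc (X : Ω → Fin jbar → ℝ) (W : Ω → ℝ) (ϑs : Fin (ibar + 1) → Fin jbar → ℝ)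
    (i : Fin (ibar + 1)) (j : Fin jbar) (θ : Fin ibar → Fin jbar → ℝ) (ω : Ω) : ℝ :=
  Lam ϑs (W ω) (X ω) * ((smx (LF (X ω)) (thetaStar ϑs) i - smx (LF (X ω)) θ i) * X ω j)

theorem gc_meas (hX : Measurable X) (hW : Measurable W) (i : Fin (ibar + 1)) (j : Fin jbar)
    (θ : Fin ibar → Fin jbar → ℝ) : Measurable (gc X W ϑs i j θ) :=
  (meas_Lam ϑs hX hW).mul (((meas_smx hX _ _).sub (meas_smx hX _ _)).mul
    ((measurable_pi_apply j).comp hX))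

theorem gc_bound (hWpos : ∀ ω, 0 ≤ W ω) (i : Fin (ibar + 1)) (j : Fin jbar)
    (θ : Fin ibar → Fin jbar → ℝ) (ω : Ω) :
    ‖gc X W ϑs i j θ ω‖ ≤ Lam ϑs (W ω) (X ω) * Real.exp (2 * normE (X ω)) := by
  rw [gc, norm_mul, Real.norm_of_nonneg (Lam_nonneg ϑs hWpos ω)]
  refine mul_le_mul_of_nonneg_left ?_ (Lam_nonneg ϑs hWpos ω)
  rw [norm_mul, Real.norm_eq_abs, Real.norm_eq_abs]
  have h1 : |smx (LF (X ω)) (thetaStar ϑs) i - smx (LF (X ω)) θ i| ≤ 1 := by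
    rw [abs_le]
    have := smx_pos (LF (X ω)) (thetaStar ϑs) i
    have := smx_pos (LF (X ω)) θ i
    have := smx_le_one (LF (X ω)) (thetaStar ϑs) i
    have := smx_le_one (LF (X ω)) θ i
    constructor <;> linarith
  calc _ ≤ 1 * normE (X ω) := mul_le_mul h1 (abs_le_normE _ _) (abs_nonneg _) zero_le_one
    _ ≤ _ := by rw [one_mul]; exact le_exp2 (normE_nonneg' _)

/-- derivative of the coefficient -/
noncomputable def gd (X : Ω → Fin jbar → ℝ) (W : Ω → ℝ) (ϑs : Fin (ibar + 1) → Fin jbar → ℝ)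
    (i : Fin (ibar + 1)) (j : Fin jbar) (θ : Fin ibar → Fin jbar → ℝ) (ω : Ω) :
    (Fin ibar → Fin jbar → ℝ) →L[ℝ] ℝ :=
  (-(Lam ϑs (W ω) (X ω) * X ω j * smx (LF (X ω)) θ i)) •
    (LF (X ω) i - ∑ k, smx (LF (X ω)) θ k • LF (X ω) k)

theorem gc_deriv (i : Fin (ibar + 1)) (j : Fin jbar) (θ : Fin ibar → Fin jbar → ℝ) (ω : Ω) :
    HasFDerivAt (fun θ => gc X W ϑs i j θ ω) (gd X W ϑs i j θ ω) θ := by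
  unfold gc gd
  refine ((((smx_deriv (LF (X ω)) θ i).const_sub (smx (LF (X ω)) (thetaStar ϑs) i)).mul_const
    (X ω j)).const_mul (Lam ϑs (W ω) (X ω))).congr_fderiv (Eq.symm ?_)
  rw [← neg_smul, smul_smul, smul_smul]
  congr 1
  ring

theorem LF_meas (hX : Measurable X) (i : Fin (ibar + 1)) :
    StronglyMeasurable (fun ω => (LF (X ω) i : (Fin ibar → Fin jbar → ℝ) →L[ℝ] ℝ)) := by
  unfold LF
  exact Finset.stronglyMeasurable_fun_sum _ fun j _ =>
    ((measurable_pi_apply j).comp hX).stronglyMeasurable.smul_const _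

theorem gd_meas (hX : Measurable X) (hW : Measurable W) (i : Fin (ibar + 1)) (j : Fin jbar)
    (θ : Fin ibar → Fin jbar → ℝ) : StronglyMeasurable (gd X W ϑs i j θ) := by
  unfold gd
  have hm : Measurable fun ω => -(Lam ϑs (W ω) (X ω) * X ω j * smx (LF (X ω)) θ i) :=
    (((meas_Lam ϑs hX hW).mul ((measurable_pi_apply j).comp hX)).mul (meas_smx hX _ _)).neg
  exact hm.stronglyMeasurable.smul ((LF_meas hX i).sub
    (Finset.stronglyMeasurable_fun_sum _ fun k _ =>
      (meas_smx hX θ k).stronglyMeasurable.smul (LF_meas hX k)))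

theorem gd_bound (hWpos : ∀ ω, 0 ≤ W ω) (i : Fin (ibar + 1)) (j : Fin jbar)
    (θ : Fin ibar → Fin jbar → ℝ) (ω : Ω) :
    ‖gd X W ϑs i j θ ω‖ ≤
      2 * jbar * (Lam ϑs (W ω) (X ω) * Real.exp (2 * normE (X ω))) := by
  have hL := Lam_nonneg (X := X) ϑs hWpos ω
  have hN := normE_nonneg' (X ω)
  have h1 : ‖LF (X ω) i - ∑ k, smx (LF (X ω)) θ k • LF (X ω) k‖ ≤
      2 * (jbar * normE (X ω)) := by
    refine (norm_sub_le _ _).trans ?_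
    have : ‖∑ k, smx (LF (X ω)) θ k • LF (ibar := ibar) (X ω) k‖ ≤ jbar * normE (X ω) := by
      refine (norm_sum_le _ _).trans ?_
      calc _ ≤ ∑ k, smx (LF (ibar := ibar) (X ω)) θ k * (jbar * normE (X ω)) := by
            refine Finset.sum_le_sum fun k _ => ?_
            rw [norm_smul, Real.norm_of_nonneg (smx_pos _ _ _).le]
            exact mul_le_mul_of_nonneg_left (LF_norm _ _) (smx_pos _ _ _).le
        _ = _ := by rw [← Finset.sum_mul, smx_sum, one_mul]
    have := LF_norm (X ω) i
    linarith
  have h2 : ‖-(Lam ϑs (W ω) (X ω) * X ω j * smx (LF (X ω)) θ i)‖ ≤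
      Lam ϑs (W ω) (X ω) * normE (X ω) := by
    rw [norm_neg, norm_mul, norm_mul, Real.norm_of_nonneg hL, Real.norm_eq_abs,
      Real.norm_of_nonneg (smx_pos _ _ _).le]
    calc _ ≤ Lam ϑs (W ω) (X ω) * normE (X ω) * 1 := by
          refine mul_le_mul ?_ (smx_le_one _ _ _) (smx_pos _ _ _).le (mul_nonneg hL hN)
          exact mul_le_mul_of_nonneg_left (abs_le_normE _ _) hL
      _ = _ := mul_one _
  rw [gd, norm_smul]
  calc _ ≤ Lam ϑs (W ω) (X ω) * normE (X ω) * (2 * (jbar * normE (X ω))) :=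
        mul_le_mul h2 h1 (norm_nonneg _) (mul_nonneg hL hN)
    _ = 2 * jbar * (Lam ϑs (W ω) (X ω) * (normE (X ω) * normE (X ω))) := by ring
    _ ≤ _ := by
        have := sq_le_exp2 hN
        gcongr

end main

theorem hess_pt {ibar jbar : ℕ} {Ω : Type*} {X : Ω → Fin jbar → ℝ} {W : Ω → ℝ}
    (ϑs : Fin (ibar + 1) → Fin jbar → ℝ) (u : Fin ibar → Fin jbar → ℝ) (ω : Ω) :
    ∑ i, ∑ j, eFun i j u * gd X W ϑs i j (thetaStar ϑs) ω u = -GamInt X W ϑs u ω := by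
  have hp : ∀ i, ∑ j, eFun i j u * gd X W ϑs i j (thetaStar ϑs) ω u =
      -(Lam ϑs (W ω) (X ω) * (smx (LF (X ω)) (thetaStar ϑs) i * (LF (X ω) i u -
        ∑ k, smx (LF (X ω)) (thetaStar ϑs) k * LF (X ω) k u) * LF (X ω) i u)) := by
    intro i
    have : LF (X ω) i u = ∑ j, X ω j * eFun i j u := by
      simp [LF, _root_.sum_apply]
    simp only [gd, _root_.sum_apply, _root_.smul_apply,
      _root_.sub_apply, smul_eq_mul]
    generalize ∑ k, smx (LF (X ω)) (thetaStar ϑs) k * LF (X ω) k u = q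
    generalize hl : LF (X ω) i u = l at *
    have h2 : ∀ m, m = l - q → ∑ j, eFun i j u * (-(Lam ϑs (W ω) (X ω) * X ω j *
        smx (LF (X ω)) (thetaStar ϑs) i) * m) =
        -(Lam ϑs (W ω) (X ω) * (smx (LF (X ω)) (thetaStar ϑs) i * m * l)) := ?_
    · exact h2 _ rfl
    intro m _
    rw [this, Finset.mul_sum, Finset.mul_sum, ← Finset.sum_neg_distrib]
    exact Finset.sum_congr rfl fun j _ => by ring
  have h0 : LF (X ω) 0 u = 0 := by simp [LF_apply, pad, dot]
  have hs : ∀ α : Fin ibar, LF (X ω) α.succ u = ∑ j, X ω j * u α j := by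
    intro α; simp [LF_apply, pad, dot]
  simp only [hp, Finset.sum_neg_distrib, ← Finset.mul_sum]
  rw [GamInt, mul_comm]
  congr 2
  rw [Fin.sum_univ_succ, h0, mul_zero, zero_add]
  refine Finset.sum_congr rfl fun α _ => ?_
  rw [Fin.sum_univ_succ, h0, mul_zero, zero_add]
  have hq : ∀ α' : Fin ibar, ∑ j : Fin jbar, ∑ j' : Fin jbar,
    ((if α = α' then rho (X ω) (pad (thetaStar ϑs)) α.succ else 0) -
      rho (X ω) (pad (thetaStar ϑs)) α.succ *
        rho (X ω) (pad (thetaStar ϑs)) α'.succ) *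
      X ω j * X ω j' * u α j * u α' j' =
    ((if α = α' then smx (LF (X ω)) (thetaStar ϑs) α.succ else 0) -
      smx (LF (X ω)) (thetaStar ϑs) α.succ *
        smx (LF (X ω)) (thetaStar ϑs) α'.succ) * (LF (X ω) α.succ u * LF (X ω) α'.succ u) := by
    intro α'
    rw [hs, hs, Finset.sum_mul_sum, Finset.mul_sum]
    refine Finset.sum_congr rfl fun j _ => ?_
    rw [Finset.mul_sum]
    refine Finset.sum_congr rfl fun j' _ => ?_
    simp only [rho_eq]
    ring
  simp only [hq]
  simp only [sub_mul, Finset.sum_sub_distrib, ite_mul, zero_mul, Finset.sum_ite_eq,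
    Finset.mem_univ, if_true]
  rw [mul_sub, sub_mul, Finset.mul_sum, Finset.sum_mul]
  congr 1
  · ring
  · exact Finset.sum_congr rfl fun k _ => by ring

/-- if `E[W·exp(c|X|)] < ∞` for every `c > 0`, then `Ȳ` is twice
differentiable on `ℝ^{ī·j̄}` (it is differentiable and its derivative is
differentiable), its gradient vanishes at `θ*`, and its Hessian at `θ*` equals
minus the matrix of the quadratic form `Γ`: for all `u`,
`(Hess Ȳ(θ*))[u⊗u] = −Γ[u⊗u]`. -/
theorem statement11 (ibar jbar : ℕ) (hibar : 1 ≤ ibar) (hjbar : 1 ≤ jbar)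
    {Ω : Type*} [MeasurableSpace Ω] (P : Measure Ω) [IsProbabilityMeasure P]
    (X : Ω → Fin jbar → ℝ) (W : Ω → ℝ)
    (hX : Measurable X) (hW : Measurable W) (hWpos : ∀ ω, 0 ≤ W ω)
    (ϑs : Fin (ibar + 1) → Fin jbar → ℝ)
    (hint : ∀ c : ℝ, 0 < c →
      Integrable (fun ω => W ω * Real.exp (c * normE (X ω))) P) :
    Differentiable ℝ (fun θ : Fin ibar → Fin jbar → ℝ => Ybar P X W ϑs θ) ∧
    Differentiable ℝ
      (fderiv ℝ (fun θ : Fin ibar → Fin jbar → ℝ => Ybar P X W ϑs θ)) ∧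
    fderiv ℝ (fun θ : Fin ibar → Fin jbar → ℝ => Ybar P X W ϑs θ)
      (thetaStar ϑs) = 0 ∧
    ∀ u : Fin ibar → Fin jbar → ℝ,
      fderiv ℝ
        (fun θ : Fin ibar → Fin jbar → ℝ =>
          fderiv ℝ (fun θ' : Fin ibar → Fin jbar → ℝ => Ybar P X W ϑs θ') θ u)
        (thetaStar ϑs) u = -Gam P X W ϑs u := by
  have hH := int_H ϑs hX hW hWpos hint
  have hcint : ∀ i j θ, Integrable (gc X W ϑs i j θ) P := fun i j θ =>
    hH.mono' (gc_meas ϑs hX hW i j θ).aestronglyMeasurable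
      (ae_of_all _ (gc_bound ϑs hWpos i j θ))
  have hdint : ∀ i j θ, Integrable (gd X W ϑs i j θ) P := fun i j θ =>
    (hH.const_mul (2 * jbar)).mono' (gd_meas ϑs hX hW i j θ).aestronglyMeasurable
      (ae_of_all _ (gd_bound ϑs hWpos i j θ))
  have hF'b : ∀ θ ω, ‖∑ i, ∑ j, gc X W ϑs i j θ ω • eFun (ibar := ibar) i j‖ ≤
      ((ibar + 1) * jbar) * (Lam ϑs (W ω) (X ω) * Real.exp (2 * normE (X ω))) := by
    intro θ ω
    calc _ ≤ ∑ i : Fin (ibar + 1), ∑ j : Fin jbar,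
          (Lam ϑs (W ω) (X ω) * Real.exp (2 * normE (X ω))) := by
          refine (norm_sum_le _ _).trans (Finset.sum_le_sum fun i _ => ?_)
          refine (norm_sum_le _ _).trans (Finset.sum_le_sum fun j _ => ?_)
          rw [norm_smul]
          have h1 := gc_bound (X := X) ϑs hWpos i j θ ω
          calc _ ≤ ‖gc X W ϑs i j θ ω‖ * 1 :=
                mul_le_mul_of_nonneg_left (eFun_norm i j) (norm_nonneg _)
            _ ≤ _ := by rw [mul_one]; exact h1
      _ = _ := by simp [mul_assoc]
  have hYint : ∀ θ, Integrable (fun ω => YbarInt X W ϑs θ ω) P := by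
    intro θ
    refine ((hH.const_mul ((ibar + 1) * jbar)).mul_const ‖θ - thetaStar ϑs‖).mono'
      (meas_Y ϑs hX hW θ).aestronglyMeasurable (ae_of_all _ fun ω => ?_)
    have h0 : YbarInt X W ϑs (thetaStar ϑs) ω = 0 := by
      rw [YbarInt_eq]; simp
    have := convex_univ.norm_image_sub_le_of_norm_hasFDerivWithin_le
      (f := fun θ => YbarInt X W ϑs θ ω)
      (fun θ _ => (YbarInt_deriv ϑs θ ω).hasFDerivWithinAt)
      (fun θ _ => hF'b θ ω) (Set.mem_univ (thetaStar ϑs)) (Set.mem_univ θ)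
    simpa only [h0, sub_zero] using this
  have hY : ∀ θ, HasFDerivAt (fun θ => Ybar P X W ϑs θ)
      (∑ i, ∑ j, (∫ ω, gc X W ϑs i j θ ω ∂P) • eFun i j) θ := by
    intro θ
    have h := hasFDerivAt_integral_of_dominated_of_fderiv_le (μ := P) (𝕜 := ℝ)
      (F := fun θ ω => YbarInt X W ϑs θ ω) (x₀ := θ) (s := Set.univ)
      (F' := fun θ ω => ∑ i, ∑ j, gc X W ϑs i j θ ω • eFun i j)
      Filter.univ_mem
      (Filter.Eventually.of_forall fun θ => (meas_Y ϑs hX hW θ).aestronglyMeasurable)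
      (hYint θ)
      (StronglyMeasurable.aestronglyMeasurable
        (Finset.stronglyMeasurable_fun_sum _ fun i _ =>
          Finset.stronglyMeasurable_fun_sum _ fun j _ =>
            (gc_meas ϑs hX hW i j θ).stronglyMeasurable.smul_const _))
      (ae_of_all _ fun ω θ _ => hF'b θ ω) (hH.const_mul _)
      (ae_of_all _ fun ω θ _ => YbarInt_deriv ϑs θ ω)
    refine h.congr_fderiv (Eq.symm ?_)
    rw [integral_finsetSum _ fun i _ => integrable_finsetSum _ fun j _ =>
      (hcint i j θ).smul_const _]
    refine Finset.sum_congr rfl fun i _ => ?_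
    rw [integral_finsetSum _ fun j _ => (hcint i j θ).smul_const _]
    exact Finset.sum_congr rfl fun j _ => by
      rw [integral_smul_const]
  have hg : ∀ i j θ, HasFDerivAt (fun θ => ∫ ω, gc X W ϑs i j θ ω ∂P)
      (∫ ω, gd X W ϑs i j θ ω ∂P) θ := by
    intro i j θ
    exact hasFDerivAt_integral_of_dominated_of_fderiv_le (μ := P) (𝕜 := ℝ)
      (F := fun θ ω => gc X W ϑs i j θ ω) (x₀ := θ) (s := Set.univ)
      (F' := fun θ ω => gd X W ϑs i j θ ω)
      Filter.univ_mem
      (Filter.Eventually.of_forall fun θ => (gc_meas ϑs hX hW i j θ).aestronglyMeasurable)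
      (hcint i j θ) (gd_meas ϑs hX hW i j θ).aestronglyMeasurable
      (ae_of_all _ fun ω θ _ => gd_bound ϑs hWpos i j θ ω) (hH.const_mul _)
      (ae_of_all _ fun ω θ _ => gc_deriv ϑs i j θ ω)
  have hfd : fderiv ℝ (fun θ : Fin ibar → Fin jbar → ℝ => Ybar P X W ϑs θ) =
      fun θ => ∑ i, ∑ j, (∫ ω, gc X W ϑs i j θ ω ∂P) • eFun i j :=
    funext fun θ => (hY θ).fderiv
  refine ⟨fun θ => (hY θ).differentiableAt, ?_, ?_, ?_⟩
  · rw [hfd]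
    exact fun θ => (HasFDerivAt.fun_sum fun i _ => HasFDerivAt.fun_sum fun j _ =>
      (hg i j θ).smul_const (eFun i j)).differentiableAt
  · rw [hfd]
    simp [gc]
  · intro u
    simp only [hfd]
    have h : HasFDerivAt (fun θ => (∑ i, ∑ j, (∫ ω, gc X W ϑs i j θ ω ∂P) •
        eFun (ibar := ibar) i j) u)
        (∑ i, ∑ j, (eFun i j u) • (∫ ω, gd X W ϑs i j (thetaStar ϑs) ω ∂P)) (thetaStar ϑs) := by
      simp only [_root_.sum_apply, _root_.smul_apply, smul_eq_mul]
      exact HasFDerivAt.fun_sum fun i _ => HasFDerivAt.fun_sum fun j _ =>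
        (hg i j _).mul_const (eFun i j u)
    rw [h.fderiv]
    simp only [_root_.sum_apply, _root_.smul_apply, smul_eq_mul]
    have hdint' : ∀ i j, Integrable (fun ω => eFun i j u * gd X W ϑs i j (thetaStar ϑs) ω u) P :=
      fun i j => ((hdint i j _).apply_continuousLinearMap u).const_mul _
    simp only [ContinuousLinearMap.integral_apply (hdint _ _ _) u, ← integral_const_mul]
    simp_rw [← integral_finsetSum _ fun j _ => hdint' _ j]
    rw [← integral_finsetSum _ fun i _ => integrable_finsetSum _ fun j _ => hdint' i j,
      Gam, ← integral_neg]
    congr 1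
    funext ω
    exact hess_pt ϑs u ω
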